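/- Let w > 2, let Γ_w be the Hecke triangle group with cusp width w, let Λ(Γ_w) be its limit set and δ := dimH Λ(Γ_w) its Hausdorff dimension, and set Λ₀ := Λ(Γ_w) ∩ {x ∈ ℂ : Im x = 0, -1 < Re x < 1}. Then there exist constants C > 0 and h₀ > 0 such that for all h ∈ (0, h₀), the two-dimensional Lebesgue measure of the open h-thickening Ω(h) := {z ∈ ℂ : dist(z, Λ₀) < h} satisfies vol(Ω(h)) ≤ C·h^(2−δ). -/

import Mathlib

open MeasureTheory

/-- `S = [[0,1],[-1,0]]` as an element of `SL(2,ℝ)`. -/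
noncomputable def S : Matrix.SpecialLinearGroup (Fin 2) ℝ :=
  ⟨!![0, 1; -1, 0], by norm_num [Matrix.det_fin_two_of]⟩

/-- `T_w = [[1,w],[0,1]]` as an element of `SL(2,ℝ)`. -/
noncomputable def T (w : ℝ) : Matrix.SpecialLinearGroup (Fin 2) ℝ :=
  ⟨!![1, w; 0, 1], by norm_num [Matrix.det_fin_two_of]⟩

/-- The Hecke triangle group `Γ_w`, the subgroup of `SL(2,ℝ)` generated by `S` and `T_w`. -/
noncomputable def heckeGroup (w : ℝ) : Subgroup (Matrix.SpecialLinearGroup (Fin 2) ℝ) :=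
  Subgroup.closure {S, T w}

/-- The Möbius action of an element of `SL(2,ℝ)` on `ℂ`. -/
noncomputable def moebius (γ : Matrix.SpecialLinearGroup (Fin 2) ℝ) (z : ℂ) : ℂ :=
  (((γ : Matrix (Fin 2) (Fin 2) ℝ) 0 0 : ℝ) * z + ((γ : Matrix (Fin 2) (Fin 2) ℝ) 0 1 : ℝ)) /
    (((γ : Matrix (Fin 2) (Fin 2) ℝ) 1 0 : ℝ) * z + ((γ : Matrix (Fin 2) (Fin 2) ℝ) 1 1 : ℝ))

/-- The limit set of a subgroup `Γ` of `SL(2,ℝ)`: the set of accumulation points in `ℂ`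
of the orbit of `i ∈ ℍ` under `Γ`. -/
noncomputable def limitSet (Γ : Subgroup (Matrix.SpecialLinearGroup (Fin 2) ℝ)) : Set ℂ :=
  {x : ℂ | AccPt x (Filter.principal ((fun γ => moebius γ Complex.I) ''
    (Γ : Set (Matrix.SpecialLinearGroup (Fin 2) ℝ))))}

section CoveringBounds

open Set Filter Topology Metric
open scoped ENNReal NNReal

/-- A finite family of maps of `F` into itself which expand distances at least by a factor `c`
and have `d`-separated images forces every finite cover of `F` to be large. -/
theorem rpow_le_sum_ediam_rpow {X ι α : Type*} [PseudoEMetricSpace X] [Fintype ι] [Nontrivial ι]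
    {F : Set X} (hF : F.Nonempty) {g : ι → X → X} (hg : ∀ i, MapsTo (g i) F F)
    {c d : ℝ≥0∞} {t : ℝ} (ht : 0 ≤ t)
    (hc : ∀ i, ∀ x ∈ F, ∀ y ∈ F, c * edist x y ≤ edist (g i x) (g i y))
    (hd : ∀ i k, i ≠ k → ∀ x ∈ F, ∀ y ∈ F, d ≤ edist (g i x) (g k y))
    (hcard : 1 ≤ (Fintype.card ι : ℝ≥0∞) * c ^ t) (J : Finset α) (U : α → Set X)
    (hU : F ⊆ ⋃ j ∈ J, U j) : d ^ t ≤ ∑ j ∈ J, ediam (U j) ^ t := by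
  classical
  induction hn : J.card using Nat.strong_induction_on generalizing J U with
  | _ n ih =>
    subst hn
    let K : ι → Finset α := fun i => J.filter fun j => (U j ∩ g i '' F).Nonempty
    by_cases hdis : ∃ i k, i ≠ k ∧ ¬ Disjoint (K i) (K k)
    · obtain ⟨i, k, hik, hnd⟩ := hdis
      obtain ⟨j, hji, hjk⟩ := Finset.not_disjoint_iff.1 hnd
      obtain ⟨hjJ, _, hjU, x, hx, rfl⟩ := Finset.mem_filter.1 hji
      obtain ⟨-, _, hjU', y, hy, rfl⟩ := Finset.mem_filter.1 hjk
      calc d ^ t ≤ ediam (U j) ^ t :=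
            ENNReal.rpow_le_rpow ((hd i k hik x hx y hy).trans (edist_le_ediam_of_mem hjU hjU')) ht
        _ ≤ _ := Finset.single_le_sum (f := fun j => ediam (U j) ^ t) (fun _ _ => zero_le) hjJ
    · push Not at hdis
      have hcov : ∀ i, ∀ x ∈ F, ∃ j ∈ K i, g i x ∈ U j := by
        intro i x hx
        obtain ⟨j, hj, hxj⟩ := mem_iUnion₂.1 (hU (hg i hx))
        exact ⟨j, Finset.mem_filter.2 ⟨hj, g i x, hxj, x, hx, rfl⟩, hxj⟩
      have hlt : ∀ i, (K i).card < J.card := by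
        intro i
        refine Finset.card_lt_card ⟨Finset.filter_subset _ _, fun hsub => ?_⟩
        obtain ⟨k, hk⟩ := exists_ne i
        obtain ⟨x, hx⟩ := hF
        obtain ⟨j, hj, -⟩ := hcov k x hx
        exact Finset.disjoint_left.1 (hdis k i hk) hj (hsub (Finset.filter_subset _ _ hj))
      have hpiece : ∀ i, c ^ t * d ^ t ≤ ∑ j ∈ K i, ediam (U j) ^ t := by
        intro i
        have h := ih _ (hlt i) (K i) (fun j => F ∩ g i ⁻¹' U j) (fun x hx => by
          obtain ⟨j, hj, hxj⟩ := hcov i x hx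
          exact mem_iUnion₂.2 ⟨j, hj, hx, hxj⟩) rfl
        calc c ^ t * d ^ t ≤ c ^ t * ∑ j ∈ K i, ediam (F ∩ g i ⁻¹' U j) ^ t := by gcongr
          _ = ∑ j ∈ K i, (c * ediam (F ∩ g i ⁻¹' U j)) ^ t := by
            rw [Finset.mul_sum]
            simp_rw [ENNReal.mul_rpow_of_nonneg _ _ ht]
          _ ≤ _ := by
            refine Finset.sum_le_sum fun j _ => ENNReal.rpow_le_rpow ?_ ht
            simp only [ediam, ENNReal.mul_iSup]
            refine iSup₂_le fun x hx => iSup₂_le fun y hy => ?_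
            exact (hc i x hx.1 y hy.1).trans (edist_le_ediam_of_mem hx.2 hy.2)
      calc d ^ t ≤ (Fintype.card ι * c ^ t) * d ^ t := le_mul_of_one_le_left zero_le hcard
        _ = ∑ _i : ι, c ^ t * d ^ t := by simp [mul_assoc]
        _ ≤ ∑ i, ∑ j ∈ K i, ediam (U j) ^ t := Finset.sum_le_sum fun i _ => hpiece i
        _ = ∑ j ∈ Finset.univ.biUnion K, ediam (U j) ^ t :=
            (Finset.sum_biUnion fun i _ k _ hik => hdis i k hik).symm
        _ ≤ _ := Finset.sum_le_sum_of_subset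
            (Finset.biUnion_subset.2 fun i _ => Finset.filter_subset _ _)

/-- A compact set of vanishing `t`-dimensional Hausdorff measure has finite covers
of arbitrarily small `t`-dimensional size. -/
theorem IsCompact.exists_finite_cover_of_hausdorffMeasure_eq_zero {X : Type*}
    [EMetricSpace X] [MeasurableSpace X] [BorelSpace X] {F : Set X} (hF : IsCompact F)
    {t : ℝ} (ht : 0 < t) (h0 : Measure.hausdorffMeasure t F = 0) {ε : ℝ≥0∞} (hε : ε ≠ 0) :
    ∃ (U : ℕ → Set X) (J : Finset ℕ), F ⊆ ⋃ j ∈ J, U j ∧ ∑ j ∈ J, ediam (U j) ^ t < ε := by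
  have hε2 : ε / 2 ≠ 0 := (ENNReal.half_pos hε).ne'
  obtain ⟨V, hFV, hV1, hVsum⟩ : ∃ V : ℕ → Set X, F ⊆ ⋃ n, V n ∧ (∀ n, ediam (V n) ≤ 1) ∧
      ∑' n, ediam (V n) ^ t < ε / 2 := by
    rw [Measure.hausdorffMeasure_apply] at h0
    have h1 : (⨅ (s : ℕ → Set X) (_ : F ⊆ ⋃ n, s n) (_ : ∀ n, ediam (s n) ≤ 1),
        ∑' n, ⨆ _ : (s n).Nonempty, ediam (s n) ^ t) < ε / 2 := by
      refine lt_of_le_of_lt ?_ (pos_iff_ne_zero.2 hε2)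
      rw [← h0]
      exact le_iSup₂_of_le (1 : ℝ≥0∞) one_pos le_rfl
    simp only [iInf_lt_iff] at h1
    obtain ⟨V, hV, hV1, hlt⟩ := h1
    refine ⟨V, hV, hV1, lt_of_le_of_lt (ENNReal.tsum_le_tsum fun n => ?_) hlt⟩
    rcases (V n).eq_empty_or_nonempty with h | h
    · simp [h, ht]
    · simp [h]
  obtain ⟨e, he, hesum⟩ := ENNReal.exists_pos_sum_of_countable hε2 ℕ
  have hη : ∀ n, ∃ η : ℝ≥0, 0 < η ∧ (ediam (V n) + 2 * η) ^ t < ediam (V n) ^ t + e n := by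
    intro n
    have hfin : ediam (V n) ≠ ∞ := ne_top_of_le_ne_top ENNReal.one_ne_top (hV1 n)
    have hcont : Tendsto (fun η : ℝ≥0 => (ediam (V n) + 2 * (η : ℝ≥0∞)) ^ t) (𝓝 0)
        (𝓝 (ediam (V n) ^ t)) := by
      have hc1 : Continuous fun η : ℝ≥0 => (ediam (V n) + 2 * (η : ℝ≥0∞)) ^ t := by
        have : Continuous fun η : ℝ≥0 => 2 * (η : ℝ≥0∞) :=
          (ENNReal.continuous_const_mul (by simp)).comp ENNReal.continuous_coe
        exact ENNReal.continuous_rpow_const.comp (continuous_const.add this)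
      simpa using hc1.tendsto 0
    have hlt : ediam (V n) ^ t < ediam (V n) ^ t + e n :=
      ENNReal.lt_add_right (ENNReal.rpow_ne_top_of_nonneg ht.le hfin)
        (by exact_mod_cast (he n).ne')
    have h2 := (hcont.eventually (gt_mem_nhds hlt)).filter_mono
      (nhdsWithin_le_nhds (s := Ioi (0 : ℝ≥0)))
    obtain ⟨η, h3, h4⟩ := (h2.and self_mem_nhdsWithin).exists
    exact ⟨η, h4, h3⟩
  choose η hη0 hηlt using hη
  obtain ⟨J, hJ⟩ := hF.elim_finite_subcover (fun n => thickening (η n) (V n))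
    (fun n => isOpen_thickening)
    (hFV.trans (iUnion_mono fun n => self_subset_thickening (by exact_mod_cast hη0 n) _))
  refine ⟨fun n => thickening (η n) (V n), J, hJ, ?_⟩
  calc ∑ j ∈ J, ediam (thickening (η j) (V j)) ^ t
      ≤ ∑ j ∈ J, (ediam (V j) ^ t + e j) := Finset.sum_le_sum fun j _ =>
        (ENNReal.rpow_le_rpow (ediam_thickening_le _) ht.le).trans (hηlt j).le
    _ ≤ ∑' j, (ediam (V j) ^ t + e j) := ENNReal.sum_le_tsum _
    _ = ∑' j, ediam (V j) ^ t + ∑' j, (e j : ℝ≥0∞) := ENNReal.tsum_add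
    _ < ε / 2 + ε / 2 := ENNReal.add_lt_add hVsum hesum
    _ = ε := ENNReal.add_halves ε

/-- If `F` is compact and contains `card ι` disjoint images of itself, each shrunk by a factor
not less than `c`, then `card ι * c ^ s ≤ 1` for every `s ≥ dimH F`. -/
theorem card_mul_rpow_le_one_of_dimH_le {X ι : Type*} [EMetricSpace X] [Fintype ι]
    {F : Set X} (hF : IsCompact F) (hne : F.Nonempty) {g : ι → X → X}
    (hg : ∀ i, MapsTo (g i) F F) (hcont : ∀ i, ContinuousOn (g i) F)
    (hdisj : ∀ i k, i ≠ k → Disjoint (g i '' F) (g k '' F)) {c : ℝ≥0} (hc0 : 0 < c) (hc1 : c ≤ 1)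
    (hc : ∀ i, ∀ x ∈ F, ∀ y ∈ F, (c : ℝ≥0∞) * edist x y ≤ edist (g i x) (g i y))
    {s : ℝ≥0} (hs : dimH F ≤ s) : (Fintype.card ι : ℝ≥0) * c ^ (s : ℝ) ≤ 1 := by
  borelize X
  by_contra! hlt
  have hcard : 1 < Fintype.card ι := by
    have h1 : c ^ (s : ℝ) ≤ 1 := NNReal.rpow_le_one hc1 s.2
    have h2 : (1 : ℝ≥0) < Fintype.card ι :=
      hlt.trans_le (mul_le_of_le_one_right zero_le h1)
    exact_mod_cast h2
  have : Nontrivial ι := Fintype.one_lt_card_iff_nontrivial.1 hcard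
  obtain ⟨t, hst, ht⟩ : ∃ t : ℝ≥0, s < t ∧ 1 < (Fintype.card ι : ℝ≥0) * c ^ (t : ℝ) := by
    have hct : Continuous fun t : ℝ≥0 => (Fintype.card ι : ℝ≥0) * c ^ (t : ℝ) :=
      continuous_const.mul <| continuous_iff_continuousAt.2 fun t =>
        tendsto_const_nhds.nnrpow (NNReal.continuous_coe.tendsto t) (.inl hc0.ne')
    have h2 := ((hct.tendsto s).eventually (lt_mem_nhds hlt)).filter_mono
      (nhdsWithin_le_nhds (s := Ioi s))
    obtain ⟨t, h3, h4⟩ := (h2.and self_mem_nhdsWithin).exists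
    exact ⟨t, h4, h3⟩
  have ht0 : (0 : ℝ) < t := by exact_mod_cast (zero_le (a := s)).trans_lt hst
  have hzero : Measure.hausdorffMeasure (t : ℝ) F = 0 :=
    hausdorffMeasure_of_dimH_lt (hs.trans_lt (by exact_mod_cast hst))
  obtain ⟨d, hd0, hd⟩ : ∃ d : ℝ≥0, 0 < d ∧
      ∀ i k, i ≠ k → ∀ x ∈ F, ∀ y ∈ F, (d : ℝ≥0∞) ≤ edist (g i x) (g k y) := by
    have hpair : ∀ i k, ∀ᶠ d : ℝ≥0 in 𝓝[>] 0,
        i ≠ k → ∀ x ∈ F, ∀ y ∈ F, (d : ℝ≥0∞) ≤ edist (g i x) (g k y) := by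
      intro i k
      by_cases hik : i = k
      · exact .of_forall fun _ h => absurd hik h
      obtain ⟨r, hr0, hr⟩ := exists_pos_forall_lt_edist (hF.image_of_continuousOn (hcont i))
        (hF.image_of_continuousOn (hcont k)).isClosed (hdisj i k hik)
      filter_upwards [nhdsWithin_le_nhds (gt_mem_nhds hr0)] with d hd _ x hx y hy
      exact (ENNReal.coe_le_coe.2 (le_of_lt hd)).trans
        (hr _ (mem_image_of_mem _ hx) _ (mem_image_of_mem _ hy)).le
    have hall := eventually_all.2 fun i => eventually_all.2 (hpair i)
    obtain ⟨d, h1, h2⟩ := (hall.and self_mem_nhdsWithin).exists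
    exact ⟨d, h2, h1⟩
  have hdt : (d : ℝ≥0∞) ^ (t : ℝ) ≠ 0 := by
    simp [ENNReal.rpow_eq_zero_iff, hd0.ne', ht0.not_gt]
  obtain ⟨U, J, hU, hsum⟩ := hF.exists_finite_cover_of_hausdorffMeasure_eq_zero ht0 hzero hdt
  refine hsum.not_ge (rpow_le_sum_ediam_rpow hne hg ht0.le hc hd ?_ J U hU)
  rw [← ENNReal.coe_rpow_of_nonneg _ ht0.le]
  exact_mod_cast ht.le

end CoveringBounds

section ContinuedFractions

open Set

/-- The inverse branch of the continued fraction map with digit `n * w`. -/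
noncomputable def cfBranch (w : ℝ) (n : ℤ) (x : ℝ) : ℝ := -1 / (x + n * w)

/-- The composition of inverse branches along a word; the head of the list is applied first. -/
noncomputable def cfWord (w : ℝ) : List {n : ℤ // n ≠ 0} → ℝ → ℝ
  | [], x => x
  | n :: u, x => cfWord w u (cfBranch w n x)

/-- The bottom row `(c, d)` of the matrix of `cfWord w u`. -/
noncomputable def cfRow (w : ℝ) : List {n : ℤ // n ≠ 0} → ℝ × ℝ
  | [] => (0, 1)
  | n :: u => ((cfRow w u).2, n * w * (cfRow w u).2 - (cfRow w u).1)

variable {w : ℝ}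

theorem le_abs_intCast_mul (hw : 2 < w) {n : ℤ} (hn : n ≠ 0) : w ≤ |(n : ℝ) * w| := by
  have h1 : (1 : ℝ) ≤ |(n : ℝ)| := by exact_mod_cast Int.one_le_abs hn
  rw [abs_mul, abs_of_pos (show (0 : ℝ) < w by linarith)]
  nlinarith

theorem sub_one_le_abs_add (hw : 2 < w) {n : ℤ} (hn : n ≠ 0) {x : ℝ} (hx : |x| ≤ 1) :
    w - 1 ≤ |x + n * w| := by
  have h1 := le_abs_intCast_mul hw hn
  have h2 : |(n : ℝ) * w| ≤ |x + n * w| + |x| := by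
    simpa using abs_sub (x + n * w) x
  linarith

theorem add_ne_zero_of_abs_le_one (hw : 2 < w) {n : ℤ} (hn : n ≠ 0) {x : ℝ} (hx : |x| ≤ 1) :
    x + n * w ≠ 0 := by
  have := sub_one_le_abs_add hw hn hx
  exact abs_pos.1 (by linarith)

theorem inv_sub_one_le_one (hw : 2 < w) : (w - 1)⁻¹ ≤ 1 := inv_le_one_of_one_le₀ (by linarith)

theorem abs_cfBranch_le (hw : 2 < w) {n : ℤ} (hn : n ≠ 0) {x : ℝ} (hx : |x| ≤ 1) :
    |cfBranch w n x| ≤ (w - 1)⁻¹ := by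
  have h := sub_one_le_abs_add hw hn hx
  rw [cfBranch, abs_div, abs_neg, abs_one, one_div]
  exact inv_anti₀ (by linarith) h

theorem abs_cfWord_le (hw : 2 < w) (u : List {n : ℤ // n ≠ 0}) {x : ℝ} (hx : |x| ≤ (w - 1)⁻¹) :
    |cfWord w u x| ≤ (w - 1)⁻¹ := by
  induction u generalizing x with
  | nil => exact hx
  | cons n u ih => exact ih (abs_cfBranch_le hw n.2 (hx.trans (inv_sub_one_le_one hw)))

theorem cfRow_bounds (hw : 2 < w) (u : List {n : ℤ // n ≠ 0}) :
    1 ≤ |(cfRow w u).2| ∧ |(cfRow w u).1| ≤ |(cfRow w u).2| := by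
  induction u with
  | nil => simp [cfRow]
  | cons n u ih =>
    obtain ⟨h1, h2⟩ := ih
    have h3 := le_abs_intCast_mul hw n.2
    have h4 : |(n : ℝ) * w * (cfRow w u).2| ≤
        |(n : ℝ) * w * (cfRow w u).2 - (cfRow w u).1| + |(cfRow w u).1| := by
      simpa using abs_add_le ((n : ℝ) * w * (cfRow w u).2 - (cfRow w u).1) (cfRow w u).1
    rw [abs_mul] at h4
    simp only [cfRow]
    constructor <;> nlinarith

theorem mul_abs_cfRow_le_cons (hw : 2 < w) (n : {n : ℤ // n ≠ 0}) (u : List {n : ℤ // n ≠ 0}) :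
    (|(n : ℝ) * w| - 1) * |(cfRow w u).2| ≤ |(cfRow w (n :: u)).2| := by
  obtain ⟨h1, h2⟩ := cfRow_bounds hw u
  have h4 : |(n : ℝ) * w * (cfRow w u).2| ≤
      |(n : ℝ) * w * (cfRow w u).2 - (cfRow w u).1| + |(cfRow w u).1| := by
    simpa using abs_add_le ((n : ℝ) * w * (cfRow w u).2 - (cfRow w u).1) (cfRow w u).1
  rw [abs_mul] at h4
  simp only [cfRow]
  linarith

theorem abs_cfRow_cons_le (hw : 2 < w) (n : {n : ℤ // n ≠ 0}) (u : List {n : ℤ // n ≠ 0}) :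
    |(cfRow w (n :: u)).2| ≤ (|(n : ℝ) * w| + 1) * |(cfRow w u).2| := by
  obtain ⟨h1, h2⟩ := cfRow_bounds hw u
  have h4 := abs_sub ((n : ℝ) * w * (cfRow w u).2) (cfRow w u).1
  rw [abs_mul] at h4
  simp only [cfRow]
  linarith

theorem abs_cfRow_le_of_suffix (hw : 2 < w) {u v : List {n : ℤ // n ≠ 0}} (h : u <:+ v) :
    |(cfRow w u).2| ≤ |(cfRow w v).2| := by
  obtain ⟨s, rfl⟩ := h
  induction s with
  | nil => rfl
  | cons n s ih =>
    have h1 := mul_abs_cfRow_le_cons hw n (s ++ u)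
    have h2 := le_abs_intCast_mul hw n.2
    have h3 := abs_nonneg (cfRow w (s ++ u)).2
    rw [List.cons_append]
    nlinarith

theorem cfRow_eval_bounds (hw : 2 < w) (u : List {n : ℤ // n ≠ 0}) {x : ℝ}
    (hx : |x| ≤ (w - 1)⁻¹) :
    (1 - (w - 1)⁻¹) * |(cfRow w u).2| ≤ |(cfRow w u).1 * x + (cfRow w u).2| ∧
      |(cfRow w u).1 * x + (cfRow w u).2| ≤ 2 * |(cfRow w u).2| := by
  obtain ⟨h1, h2⟩ := cfRow_bounds hw u
  have h3 : |(cfRow w u).1 * x| ≤ |(cfRow w u).2| * (w - 1)⁻¹ := by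
    rw [abs_mul]
    exact mul_le_mul h2 hx (abs_nonneg _) (abs_nonneg _)
  have h4 := abs_add_le ((cfRow w u).1 * x) (cfRow w u).2
  have h5 : |(cfRow w u).2| ≤ |(cfRow w u).1 * x + (cfRow w u).2| + |(cfRow w u).1 * x| := by
    simpa using abs_sub ((cfRow w u).1 * x + (cfRow w u).2) ((cfRow w u).1 * x)
  have h6 := inv_sub_one_le_one hw
  constructor <;> nlinarith

theorem inv_sub_one_lt_one (hw : 2 < w) : (w - 1)⁻¹ < 1 := inv_lt_one_of_one_lt₀ (by linarith)

theorem cfRow_eval_ne_zero (hw : 2 < w) (u : List {n : ℤ // n ≠ 0}) {x : ℝ}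
    (hx : |x| ≤ (w - 1)⁻¹) : (cfRow w u).1 * x + (cfRow w u).2 ≠ 0 := by
  have h1 := (cfRow_eval_bounds hw u hx).1
  have h2 := (cfRow_bounds hw u).1
  have h3 := inv_sub_one_lt_one hw
  refine abs_pos.1 (lt_of_lt_of_le ?_ h1)
  exact mul_pos (by linarith) (by linarith)

theorem cfWord_sub_cfWord (hw : 2 < w) (u : List {n : ℤ // n ≠ 0}) {x y : ℝ}
    (hx : |x| ≤ (w - 1)⁻¹) (hy : |y| ≤ (w - 1)⁻¹) :
    cfWord w u x - cfWord w u y = (x - y) /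
      (((cfRow w u).1 * x + (cfRow w u).2) * ((cfRow w u).1 * y + (cfRow w u).2)) := by
  induction u generalizing x y with
  | nil => simp [cfWord, cfRow]
  | cons n u ih =>
    have hx1 := hx.trans (inv_sub_one_le_one hw)
    have hy1 := hy.trans (inv_sub_one_le_one hw)
    have hx0 := add_ne_zero_of_abs_le_one hw n.2 hx1
    have hy0 := add_ne_zero_of_abs_le_one hw n.2 hy1
    have key : ∀ z : ℝ, z + (n : ℝ) * w ≠ 0 →
        (cfRow w u).1 * cfBranch w n z + (cfRow w u).2 =
          ((cfRow w (n :: u)).1 * z + (cfRow w (n :: u)).2) / (z + n * w) := by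
      intro z hz
      simp only [cfRow, cfBranch]
      field_simp
      ring
    have hsub : cfBranch w n x - cfBranch w n y = (x - y) / ((x + n * w) * (y + n * w)) := by
      simp only [cfBranch]
      field_simp
      ring
    have hx2 := cfRow_eval_ne_zero hw (n :: u) hx
    have hy2 := cfRow_eval_ne_zero hw (n :: u) hy
    rw [cfWord, cfWord, ih (abs_cfBranch_le hw n.2 hx1) (abs_cfBranch_le hw n.2 hy1), key x hx0,
      key y hy0, hsub]
    field_simp

theorem abs_sub_le_abs_cfWord_sub (hw : 2 < w) (u : List {n : ℤ // n ≠ 0}) {x y : ℝ}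
    (hx : |x| ≤ (w - 1)⁻¹) (hy : |y| ≤ (w - 1)⁻¹) :
    |x - y| / (4 * |(cfRow w u).2| ^ 2) ≤ |cfWord w u x - cfWord w u y| := by
  have h1 := (cfRow_eval_bounds hw u hx).2
  have h2 := (cfRow_eval_bounds hw u hy).2
  have h3 := abs_pos.2 (cfRow_eval_ne_zero hw u hx)
  have h4 := abs_pos.2 (cfRow_eval_ne_zero hw u hy)
  rw [cfWord_sub_cfWord hw u hx hy, abs_div, abs_mul]
  refine div_le_div_of_nonneg_left (abs_nonneg _) (by positivity) ?_
  calc _ ≤ (2 * |(cfRow w u).2|) * (2 * |(cfRow w u).2|) := by gcongr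
    _ = _ := by ring

theorem abs_cfWord_sub_cfWord_zero_le (hw : 2 < w) (u : List {n : ℤ // n ≠ 0}) {x : ℝ}
    (hx : |x| ≤ (w - 1)⁻¹) :
    |cfWord w u x - cfWord w u 0| ≤ |x| / ((1 - (w - 1)⁻¹) * |(cfRow w u).2| ^ 2) := by
  have h0 : |(0 : ℝ)| ≤ (w - 1)⁻¹ := by
    rw [abs_zero, inv_nonneg]; linarith
  have h1 := (cfRow_eval_bounds hw u hx).1
  have h2 := (cfRow_bounds hw u).1
  have h3 := inv_sub_one_lt_one hw
  rw [cfWord_sub_cfWord hw u hx h0, abs_div, abs_mul, sub_zero, mul_zero, zero_add]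
  refine div_le_div_of_nonneg_left (abs_nonneg _) ?_ ?_
  · exact mul_pos (by linarith) (by positivity)
  · nlinarith

theorem continuousOn_cfWord (hw : 2 < w) (u : List {n : ℤ // n ≠ 0}) :
    ContinuousOn (cfWord w u) {x | |x| ≤ (w - 1)⁻¹} := by
  induction u with
  | nil => exact continuousOn_id
  | cons n u ih =>
    refine ContinuousOn.comp (g := cfWord w u) ih ?_ fun x hx =>
      abs_cfBranch_le hw n.2 (le_trans hx (inv_sub_one_le_one hw))
    exact continuousOn_const.div (by fun_prop) fun x hx =>
      add_ne_zero_of_abs_le_one hw n.2 (le_trans hx (inv_sub_one_le_one hw))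

theorem cfWord_append_singleton (u : List {n : ℤ // n ≠ 0}) (n : {n : ℤ // n ≠ 0}) (x : ℝ) :
    cfWord w (u ++ [n]) x = cfBranch w n (cfWord w u x) := by
  induction u generalizing x with
  | nil => rfl
  | cons m u ih => exact ih _

theorem cfBranch_inj (hw : 2 < w) {m n : ℤ} (hm : m ≠ 0) (hn : n ≠ 0) {x y : ℝ}
    (hx : |x| ≤ (w - 1)⁻¹) (hy : |y| ≤ (w - 1)⁻¹) (h : cfBranch w m x = cfBranch w n y) :
    m = n ∧ x = y := by
  have h1 := inv_sub_one_le_one hw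
  have hx0 := add_ne_zero_of_abs_le_one hw hm (hx.trans h1)
  have hy0 := add_ne_zero_of_abs_le_one hw hn (hy.trans h1)
  have h2 : x + m * w = y + n * w := by
    rw [cfBranch, cfBranch, div_eq_div_iff hx0 hy0] at h
    linarith
  have h3 : m = n := by
    by_contra hne
    have h4 := le_abs_intCast_mul hw (sub_ne_zero.2 hne)
    have h5 : ((m - n : ℤ) : ℝ) * w = y - x := by push_cast; linarith
    rw [h5] at h4
    have h6 := abs_sub y x
    linarith
  subst h3
  exact ⟨rfl, by linarith⟩

theorem suffix_or_suffix_of_cfWord_eq (hw : 2 < w) {u v : List {n : ℤ // n ≠ 0}} {x y : ℝ}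
    (hx : |x| ≤ (w - 1)⁻¹) (hy : |y| ≤ (w - 1)⁻¹) (h : cfWord w u x = cfWord w v y) :
    u <:+ v ∨ v <:+ u := by
  induction u using List.reverseRecOn generalizing v with
  | nil => exact .inl (List.nil_suffix)
  | append_singleton u m ih =>
    rcases List.eq_nil_or_concat v with rfl | ⟨v, n, rfl⟩
    · exact .inr (List.nil_suffix)
    · rw [List.concat_eq_append] at *
      rw [cfWord_append_singleton, cfWord_append_singleton] at h
      obtain ⟨hmn, hxy⟩ := cfBranch_inj hw m.2 n.2 (abs_cfWord_le hw u hx)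
        (abs_cfWord_le hw v hy) h
      obtain rfl : m = n := Subtype.ext hmn
      rcases ih hxy with ⟨s, rfl⟩ | ⟨s, rfl⟩
      · exact .inl ⟨s, by simp⟩
      · exact .inr ⟨s, by simp⟩

/-- Words that leave the region `|d| ≤ H` exactly at their last digit have disjoint images. -/
theorem disjoint_image_cfWord (hw : 2 < w) {F : Set ℝ} (hF : ∀ x ∈ F, |x| ≤ (w - 1)⁻¹) {H : ℝ}
    {m n : {n : ℤ // n ≠ 0}} {u v : List {n : ℤ // n ≠ 0}}
    (hu : |(cfRow w u).2| ≤ H) (hv : |(cfRow w v).2| ≤ H)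
    (hmu : H < |(cfRow w (m :: u)).2|) (hnv : H < |(cfRow w (n :: v)).2|)
    (hne : m :: u ≠ n :: v) :
    Disjoint (cfWord w (m :: u) '' F) (cfWord w (n :: v) '' F) := by
  refine disjoint_left.2 ?_
  rintro _ ⟨x, hx, rfl⟩ ⟨y, hy, hxy⟩
  rcases suffix_or_suffix_of_cfWord_eq hw (hF x hx) (hF y hy) hxy.symm with h | h
  · rcases List.suffix_cons_iff.1 h with h | h
    · exact hne h
    · exact (hmu.trans_le (abs_cfRow_le_of_suffix hw h)).not_ge hv
  · rcases List.suffix_cons_iff.1 h with h | h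
    · exact hne h.symm
    · exact (hnv.trans_le (abs_cfRow_le_of_suffix hw h)).not_ge hu

/-- Every point of a set that is backward invariant under the branches, up to `0`, lies close to
the image of `0` under a word with `|d| ≤ H`. -/
theorem exists_abs_sub_cfWord_zero_le (hw : 2 < w) {F : Set ℝ} (hF : ∀ x ∈ F, |x| ≤ (w - 1)⁻¹)
    (hback : ∀ x ∈ F, x ≠ 0 → ∃ n : {n : ℤ // n ≠ 0}, ∃ y ∈ F, x = cfBranch w n y)
    {H : ℝ} (hH : 1 ≤ H) {x : ℝ} (hx : x ∈ F) :
    ∃ u, |(cfRow w u).2| ≤ H ∧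
      |x - cfWord w u 0| ≤ 3 / (1 - (w - 1)⁻¹) / (H * |(cfRow w u).2|) := by
  have h3 := inv_sub_one_lt_one hw
  have hone : (0 : ℝ) < 1 - (w - 1)⁻¹ := by linarith
  suffices hmain : ∀ k : ℕ, ∀ u, |(cfRow w u).2| ≤ H → H < |(cfRow w u).2| * (w - 1) ^ k →
      ∀ y ∈ F, ∃ v, |(cfRow w v).2| ≤ H ∧ ∃ z ∈ F, cfWord w u y = cfWord w v z ∧
        |z| ≤ 3 * |(cfRow w v).2| / H by
    obtain ⟨k, hk⟩ := pow_unbounded_of_one_lt H (show 1 < w - 1 by linarith)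
    obtain ⟨v, hv, z, hz, hxz, hzH⟩ := hmain k [] (by simpa [cfRow] using hH)
      (by simpa [cfRow] using hk) x hx
    refine ⟨v, hv, ?_⟩
    have hd := (cfRow_bounds hw v).1
    have hd0 : 0 < |(cfRow w v).2| := by linarith
    have hH0 : 0 < H := by linarith
    change x = _ at hxz
    rw [hxz]
    calc _ ≤ |z| / ((1 - (w - 1)⁻¹) * |(cfRow w v).2| ^ 2) :=
          abs_cfWord_sub_cfWord_zero_le hw v (hF z hz)
      _ ≤ (3 * |(cfRow w v).2| / H) / ((1 - (w - 1)⁻¹) * |(cfRow w v).2| ^ 2) := by gcongr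
      _ = _ := by field_simp
  intro k
  induction k with
  | zero => intro u h1 h2; simp at h2; linarith
  | succ k ih =>
    intro u hu huk y hy
    have hd := (cfRow_bounds hw u).1
    by_cases hy0 : y = 0
    · refine ⟨u, hu, y, hy, rfl, ?_⟩
      rw [hy0, abs_zero]
      positivity
    obtain ⟨n, z, hz, rfl⟩ := hback y hy hy0
    have hn := le_abs_intCast_mul hw n.2
    by_cases hnu : |(cfRow w (n :: u)).2| ≤ H
    · refine ih (n :: u) hnu (huk.trans_le ?_) z hz
      have h1 := mul_abs_cfRow_le_cons hw n u
      have h2 : (w - 1) * |(cfRow w u).2| ≤ |(cfRow w (n :: u)).2| := by nlinarith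
      have h4 : (0 : ℝ) ≤ (w - 1) ^ k := pow_nonneg (by linarith) k
      rw [pow_succ]
      nlinarith
    · refine ⟨u, hu, _, hy, rfl, ?_⟩
      have h1 := abs_cfRow_cons_le hw n u
      have hz1 := (hF z hz).trans (inv_sub_one_le_one hw)
      have h2 : |(n : ℝ) * w| ≤ |z + n * w| + |z| := by simpa using abs_sub (z + n * w) z
      have h4 : 0 < |z + (n : ℝ) * w| := by linarith
      rw [cfBranch, abs_div, abs_neg, abs_one, div_le_div_iff₀ h4 (by linarith)]
      have h5 : |(n : ℝ) * w| + 1 ≤ 3 * |z + n * w| := by linarith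
      nlinarith

end ContinuedFractions

section LimitSet

open Set Filter Topology

theorem coe_S : (S : Matrix (Fin 2) (Fin 2) ℝ) = !![0, 1; -1, 0] := rfl

theorem coe_S_inv : ((S⁻¹ : Matrix.SpecialLinearGroup (Fin 2) ℝ) : Matrix (Fin 2) (Fin 2) ℝ) =
    !![0, -1; 1, 0] := by
  rw [Matrix.SpecialLinearGroup.coe_inv, coe_S, Matrix.adjugate_fin_two_of]
  simp

theorem coe_T (w : ℝ) : (T w : Matrix (Fin 2) (Fin 2) ℝ) = !![1, w; 0, 1] := rfl

theorem moebius_S_mul (γ : Matrix.SpecialLinearGroup (Fin 2) ℝ) (z : ℂ) :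
    moebius (S * γ) z = -1 / moebius γ z := by
  simp only [moebius, Matrix.SpecialLinearGroup.coe_mul, coe_S, Matrix.mul_apply,
    Fin.sum_univ_two, Matrix.of_apply, Matrix.cons_val', Matrix.cons_val_zero, Matrix.cons_val_one,
    Matrix.cons_val_fin_one, zero_mul, one_mul, neg_mul, zero_add, add_zero, Complex.ofReal_neg]
  rw [div_div_eq_mul_div, ← neg_add, div_neg, neg_one_mul, neg_div]

theorem moebius_S_inv_mul (γ : Matrix.SpecialLinearGroup (Fin 2) ℝ) (z : ℂ) :
    moebius (S⁻¹ * γ) z = -1 / moebius γ z := by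
  simp only [moebius, Matrix.SpecialLinearGroup.coe_mul, coe_S_inv, Matrix.mul_apply,
    Fin.sum_univ_two, Matrix.of_apply, Matrix.cons_val', Matrix.cons_val_zero, Matrix.cons_val_one,
    Matrix.cons_val_fin_one, zero_mul, one_mul, neg_mul, zero_add, add_zero, Complex.ofReal_neg]
  rw [div_div_eq_mul_div, ← neg_add, neg_one_mul]

theorem moebius_denom_I_ne_zero (γ : Matrix.SpecialLinearGroup (Fin 2) ℝ) :
    (γ.1 1 0 : ℂ) * Complex.I + (γ.1 1 1 : ℂ) ≠ 0 := by
  intro h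
  have h0 := congrArg Complex.re h
  have h1 := congrArg Complex.im h
  simp at h0 h1
  have hdet := γ.2
  rw [Matrix.det_fin_two, h0, h1] at hdet
  simp at hdet

theorem moebius_T_mul (w : ℝ) (γ : Matrix.SpecialLinearGroup (Fin 2) ℝ) :
    moebius (T w * γ) Complex.I = moebius γ Complex.I + w := by
  have h := moebius_denom_I_ne_zero γ
  simp only [moebius, Matrix.SpecialLinearGroup.coe_mul, coe_T, Matrix.mul_apply, Fin.sum_univ_two,
    Matrix.of_apply, Matrix.cons_val', Matrix.cons_val_zero, Matrix.cons_val_one,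
    Matrix.cons_val_fin_one, zero_mul, one_mul, zero_add, Complex.ofReal_add, Complex.ofReal_mul]
  rw [div_add' _ _ _ h]
  congr 1
  ring

theorem moebius_T_inv_mul (w : ℝ) (γ : Matrix.SpecialLinearGroup (Fin 2) ℝ) :
    moebius ((T w)⁻¹ * γ) Complex.I = moebius γ Complex.I - w := by
  have h := moebius_T_mul w ((T w)⁻¹ * γ)
  rw [mul_inv_cancel_left] at h
  rw [h, add_sub_cancel_right]

/-- The orbit of `i` under the Hecke group. -/
def heckeOrbit (w : ℝ) : Set ℂ :=
  (fun γ => moebius γ Complex.I) '' (heckeGroup w : Set (Matrix.SpecialLinearGroup (Fin 2) ℝ))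

theorem mem_limitSet_iff {w : ℝ} {x : ℂ} :
    x ∈ limitSet (heckeGroup w) ↔ ∃ᶠ y in 𝓝 x, y ≠ x ∧ y ∈ heckeOrbit w :=
  accPt_iff_frequently

theorem isClosed_limitSet (Γ : Subgroup (Matrix.SpecialLinearGroup (Fin 2) ℝ)) :
    IsClosed (limitSet Γ) := isClosed_derivedSet _

theorem neg_one_div_mem_heckeOrbit {w : ℝ} {z : ℂ} (hz : z ∈ heckeOrbit w) :
    -1 / z ∈ heckeOrbit w := by
  obtain ⟨γ, hγ, rfl⟩ := hz
  exact ⟨S * γ, mul_mem (Subgroup.subset_closure (by simp)) hγ, moebius_S_mul _ _⟩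

theorem add_intCast_mul_mem_heckeOrbit {w : ℝ} {z : ℂ} (hz : z ∈ heckeOrbit w) (n : ℤ) :
    z + n * w ∈ heckeOrbit w := by
  have hT : T w ∈ heckeGroup w := Subgroup.subset_closure (by simp)
  induction n with
  | zero => simpa using hz
  | succ n ih =>
    obtain ⟨γ, hγ, h⟩ := ih
    refine ⟨T w * γ, mul_mem hT hγ, ?_⟩
    dsimp only at h ⊢
    rw [moebius_T_mul, h]
    push_cast
    ring
  | pred n ih =>
    obtain ⟨γ, hγ, h⟩ := ih
    refine ⟨(T w)⁻¹ * γ, mul_mem (inv_mem hT) hγ, ?_⟩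
    dsimp only at h ⊢
    rw [moebius_T_inv_mul, h]
    push_cast
    ring

/-- The points of the orbit of `i` produced by the inverse branches of the continued fraction
map. -/
inductive ReducedOrbit (w : ℝ) : ℂ → Prop
  | base : ReducedOrbit w Complex.I
  | branch (n : ℤ) (hn : n ≠ 0) (z : ℂ) (hz : ReducedOrbit w z) :
      ReducedOrbit w (-1 / (z + n * w))

theorem ReducedOrbit.eq_I_or_norm_le {w : ℝ} (hw : 2 < w) {z : ℂ} (hz : ReducedOrbit w z) :
    z = Complex.I ∨ ‖z‖ ≤ (w - 1)⁻¹ := by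
  induction hz with
  | base => exact .inl rfl
  | branch n hn z _ ih =>
    right
    have h1 : ‖z‖ ≤ 1 := by
      rcases ih with rfl | h
      · simp
      · exact h.trans (inv_sub_one_le_one hw)
    have h2 := le_abs_intCast_mul hw hn
    have h3 : |(n : ℝ) * w| ≤ ‖z + n * w‖ + ‖z‖ := by
      have h4 : ‖(n : ℂ) * w‖ = |(n : ℝ) * w| := by
        rw [← Real.norm_eq_abs, ← Complex.norm_real]
        push_cast
        rfl
      rw [← h4]
      simpa using norm_sub_le (z + n * w) z
    rw [norm_div, norm_neg, norm_one, one_div]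
    exact inv_anti₀ (by linarith) (by linarith)

theorem exists_reducedOrbit_of_mem_heckeOrbit {w : ℝ} {z : ℂ} (hz : z ∈ heckeOrbit w) :
    ∃ b, ReducedOrbit w b ∧ ∃ n : ℤ, z = b + n * w := by
  have hinv : ∀ z : ℂ, (∃ b, ReducedOrbit w b ∧ ∃ n : ℤ, z = b + n * w) →
      ∃ b, ReducedOrbit w b ∧ ∃ n : ℤ, -1 / z = b + n * w := by
    rintro _ ⟨b, hb, n, rfl⟩
    by_cases hn : n = 0
    · subst hn
      cases hb with
      | base => exact ⟨Complex.I, .base, 0, by simp [neg_div]⟩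
      | branch m hm b' hb' => exact ⟨b', hb', m, by simp [neg_div]⟩
    · exact ⟨_, .branch n hn b hb, 0, by simp⟩
  obtain ⟨γ, hγ, rfl⟩ := hz
  dsimp only
  induction hγ using Subgroup.closure_induction_left with
  | one => exact ⟨Complex.I, .base, 0, by simp [moebius]⟩
  | mul_left x hx γ _ ih =>
    rcases hx with rfl | rfl
    · rw [moebius_S_mul]
      exact hinv _ ih
    · obtain ⟨b, hb, n, h⟩ := ih
      exact ⟨b, hb, n + 1, by rw [moebius_T_mul, h]; push_cast; ring⟩
  | inv_mul_cancel x hx γ _ ih =>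
    rcases hx with rfl | rfl
    · rw [moebius_S_inv_mul]
      exact hinv _ ih
    · obtain ⟨b, hb, n, h⟩ := ih
      exact ⟨b, hb, n - 1, by rw [moebius_T_inv_mul, h]; push_cast; ring⟩

theorem add_intCast_mul_mem_limitSet {w : ℝ} {x : ℂ} (hx : x ∈ limitSet (heckeGroup w)) (n : ℤ) :
    x + n * w ∈ limitSet (heckeGroup w) := by
  rw [mem_limitSet_iff] at hx ⊢
  have hf : Tendsto (fun y : ℂ => y + n * w) (𝓝 x) (𝓝 (x + n * w)) :=
    (continuous_id.add continuous_const).tendsto x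
  exact hf.frequently (hx.mono fun y hy =>
    ⟨fun h => hy.1 (add_right_cancel h), add_intCast_mul_mem_heckeOrbit hy.2 n⟩)

theorem neg_one_div_mem_limitSet {w : ℝ} {x : ℂ} (hx : x ∈ limitSet (heckeGroup w))
    (hx0 : x ≠ 0) : -1 / x ∈ limitSet (heckeGroup w) := by
  rw [mem_limitSet_iff] at hx ⊢
  have hf : Tendsto (fun y : ℂ => -1 / y) (𝓝 x) (𝓝 (-1 / x)) :=
    tendsto_const_nhds.div tendsto_id hx0
  refine hf.frequently (hx.mono fun y hy => ⟨fun h => hy.1 ?_, neg_one_div_mem_heckeOrbit hy.2⟩)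
  simpa [neg_div] using h

/-- Real limit points are at distance at most `1 / (w - 1)` from the lattice `ℤ w`. -/
theorem abs_sub_round_mul_le_of_mem_limitSet {w : ℝ} (hw : 2 < w) {x : ℝ}
    (hx : (x : ℂ) ∈ limitSet (heckeGroup w)) : |x - round (x / w) * w| ≤ (w - 1)⁻¹ := by
  refine le_of_forall_pos_le_add fun ε hε => ?_
  rw [mem_limitSet_iff] at hx
  obtain ⟨z, ⟨-, hz⟩, hzx⟩ :=
    (hx.and_eventually (Metric.ball_mem_nhds _ (lt_min hε one_pos))).exists
  rw [dist_eq_norm, lt_min_iff] at hzx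
  obtain ⟨b, hb, n, rfl⟩ := exists_reducedOrbit_of_mem_heckeOrbit hz
  have him := (Complex.abs_im_le_norm _).trans_lt hzx.2
  have hre := (Complex.abs_re_le_norm _).trans_lt hzx.1
  have hb' : |b.re| ≤ (w - 1)⁻¹ := by
    rcases hb.eq_I_or_norm_le hw with rfl | h
    · simp at him
    · exact (Complex.abs_re_le_norm b).trans h
  have hround : |x - round (x / w) * w| ≤ |x - n * w| := by
    have h0 : 0 < w := by linarith
    have h1 := mul_le_mul_of_nonneg_right (round_le (x / w) n) h0.le
    rw [← abs_of_pos h0, ← abs_mul, ← abs_mul, abs_of_pos h0, sub_mul, sub_mul,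
      div_mul_cancel₀ _ h0.ne'] at h1
    exact h1
  simp at hre
  have h2 := abs_sub b.re (b.re + n * w - x)
  rw [show b.re - (b.re + n * w - x) = x - n * w by ring] at h2
  linarith

/-- The real limit points within `1 / (w - 1)` of the origin. -/
def heckeCore (w : ℝ) : Set ℝ := {x | (x : ℂ) ∈ limitSet (heckeGroup w) ∧ |x| ≤ (w - 1)⁻¹}

theorem isCompact_heckeCore (w : ℝ) : IsCompact (heckeCore w) := by
  refine Metric.isCompact_of_isClosed_isBounded ?_ ?_
  · exact ((isClosed_limitSet _).preimage Complex.continuous_ofReal).inter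
      (isClosed_le continuous_abs continuous_const)
  · refine (Metric.isBounded_Icc (-(w - 1)⁻¹) (w - 1)⁻¹).subset fun x hx => abs_le.1 hx.2

theorem mem_heckeCore_of_abs_lt_one {w : ℝ} (hw : 2 < w) {x : ℝ}
    (hx : (x : ℂ) ∈ limitSet (heckeGroup w)) (hx1 : |x| < 1) : x ∈ heckeCore w := by
  have h1 := abs_sub_round_mul_le_of_mem_limitSet hw hx
  by_cases h0 : round (x / w) = 0
  · rw [h0] at h1
    exact ⟨hx, by simpa using h1⟩
  · have h2 := le_abs_intCast_mul hw h0
    have h3 := abs_sub x (x - round (x / w) * w)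
    rw [sub_sub_cancel] at h3
    have h4 := inv_sub_one_le_one hw
    linarith

theorem cfBranch_mem_heckeCore {w : ℝ} (hw : 2 < w) {n : ℤ} (hn : n ≠ 0) {x : ℝ}
    (hx : x ∈ heckeCore w) : cfBranch w n x ∈ heckeCore w := by
  have hx1 := hx.2.trans (inv_sub_one_le_one hw)
  refine ⟨?_, abs_cfBranch_le hw hn hx1⟩
  have h0 : ((x : ℂ) + n * w) ≠ 0 := by
    exact_mod_cast add_ne_zero_of_abs_le_one hw hn hx1
  have h := neg_one_div_mem_limitSet (add_intCast_mul_mem_limitSet hx.1 n) h0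
  simpa [cfBranch] using h

theorem cfWord_mem_heckeCore {w : ℝ} (hw : 2 < w) (u : List {n : ℤ // n ≠ 0}) {x : ℝ}
    (hx : x ∈ heckeCore w) : cfWord w u x ∈ heckeCore w := by
  induction u generalizing x with
  | nil => exact hx
  | cons n u ih => exact ih (cfBranch_mem_heckeCore hw n.2 hx)

theorem exists_eq_cfBranch_of_mem_heckeCore {w : ℝ} (hw : 2 < w) {x : ℝ} (hx : x ∈ heckeCore w)
    (hx0 : x ≠ 0) : ∃ n : {n : ℤ // n ≠ 0}, ∃ y ∈ heckeCore w, x = cfBranch w n y := by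
  have hmem : ((-1 / x : ℝ) : ℂ) ∈ limitSet (heckeGroup w) := by
    simpa using neg_one_div_mem_limitSet hx.1 (by exact_mod_cast hx0)
  have hy := abs_sub_round_mul_le_of_mem_limitSet hw hmem
  set n := round (-1 / x / w) with hn
  have hn0 : n ≠ 0 := by
    intro h0
    rw [h0, Int.cast_zero, zero_mul, sub_zero, abs_div, abs_neg, abs_one, one_div] at hy
    have h1 : w - 1 ≤ |x|⁻¹ := by
      rw [le_inv_comm₀ (by linarith) (abs_pos.2 hx0)]
      exact hx.2
    have h2 := inv_sub_one_le_one hw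
    linarith
  refine ⟨⟨n, hn0⟩, -1 / x - n * w, ⟨?_, hy⟩, ?_⟩
  · have h := add_intCast_mul_mem_limitSet hmem (-n)
    push_cast at h ⊢
    rwa [neg_mul, ← sub_eq_add_neg] at h
  · simp only [cfBranch, sub_add_cancel]
    field_simp

theorem dimH_heckeCore_le (w : ℝ) : dimH (heckeCore w) ≤ dimH (limitSet (heckeGroup w)) := by
  rw [← Complex.isometry_ofReal.dimH_image]
  exact dimH_mono (image_subset_iff.2 fun x hx => hx.1)

theorem dimH_limitSet_ne_top (Γ : Subgroup (Matrix.SpecialLinearGroup (Fin 2) ℝ)) :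
    dimH (limitSet Γ) ≠ ⊤ := by
  refine ne_top_of_le_ne_top ?_ (dimH_mono (subset_univ _))
  rw [Real.dimH_univ_eq_finrank]
  exact ENNReal.natCast_ne_top _

end LimitSet

section Volume

open Set
open scoped NNReal ENNReal

theorem volume_reProdIm_Icc (a b c d : ℝ) :
    volume (Icc a b ×ℂ Icc c d) = ENNReal.ofReal (b - a) * ENNReal.ofReal (d - c) := by
  have h : Icc a b ×ℂ Icc c d = Complex.measurableEquivRealProd ⁻¹' (Icc a b ×ˢ Icc c d) := rfl
  rw [h, Complex.volume_preserving_equiv_real_prod.measure_preimage_equiv, Measure.volume_eq_prod,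
    Measure.prod_prod, Real.volume_Icc, Real.volume_Icc]

/-- The number of words that just leave the region `|d| ≤ H` is controlled by the Hausdorff
dimension. -/
theorem sum_floor_mul_rpow_le_one {w : ℝ} (hw : 2 < w) {H : ℝ} (hH : 1 ≤ H) {s : ℝ≥0}
    (hs : dimH (heckeCore w) ≤ s) (hne : (heckeCore w).Nonempty)
    (A : Finset {u : List {n : ℤ // n ≠ 0} // |(cfRow w u).2| ≤ H}) :
    (∑ u ∈ A, (⌊H / |(cfRow w u.1).2|⌋₊ : ℝ)) * (1 / (4 * ((2 * w + 1) * H) ^ 2)) ^ (s : ℝ) ≤ 1 := by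
  set q : {u : List {n : ℤ // n ≠ 0} // |(cfRow w u).2| ≤ H} → ℕ :=
    fun u => ⌊H / |(cfRow w u.1).2|⌋₊ with hq
  let ι := (u : A) × Fin (q u)
  let digit : ι → {n : ℤ // n ≠ 0} := fun i => ⟨(q i.1 + 1 + i.2.1 : ℕ), by positivity⟩
  have hH0 : 0 < H := by linarith
  have hdigit : ∀ i : ι, |((digit i : ℤ) : ℝ) * w| = (q i.1 + 1 + i.2.1 : ℕ) * w := by
    intro i
    have : (0 : ℝ) ≤ (q i.1 + 1 + i.2.1 : ℕ) * w := mul_nonneg (Nat.cast_nonneg _) (by linarith)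
    simpa [digit] using abs_of_nonneg this
  have hlow : ∀ i : ι, H < |(cfRow w (digit i :: i.1.1.1)).2| := by
    intro i
    have h1 := mul_abs_cfRow_le_cons hw (digit i) i.1.1.1
    rw [hdigit] at h1
    have hd := (cfRow_bounds hw i.1.1.1).1
    have h2 : H < (q i.1 + 1 : ℝ) * |(cfRow w i.1.1.1).2| := by
      rw [← div_lt_iff₀ (by linarith)]
      exact Nat.lt_floor_add_one _
    have h3 : (q i.1 + 1 : ℝ) ≤ (q i.1 + 1 + i.2.1 : ℕ) * w - 1 := by
      push_cast
      have : (0 : ℝ) ≤ q i.1 := Nat.cast_nonneg _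
      have : (0 : ℝ) ≤ i.2.1 := Nat.cast_nonneg _
      nlinarith
    nlinarith
  have hupp : ∀ i : ι, |(cfRow w (digit i :: i.1.1.1)).2| ≤ (2 * w + 1) * H := by
    intro i
    have h1 := abs_cfRow_cons_le hw (digit i) i.1.1.1
    rw [hdigit] at h1
    have hd := (cfRow_bounds hw i.1.1.1).1
    have h2 : (q i.1 : ℝ) * |(cfRow w i.1.1.1).2| ≤ H := by
      rw [← le_div_iff₀ (by linarith)]
      exact Nat.floor_le (by positivity)
    have h3 : ((q i.1 + 1 + i.2.1 : ℕ) : ℝ) ≤ 2 * q i.1 := by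
      have := i.2.2
      exact_mod_cast (by omega : q i.1 + 1 + i.2.1 ≤ 2 * q i.1)
    have h4 := i.1.1.2
    calc _ ≤ _ := h1
      _ ≤ (2 * q i.1 * w + 1) * |(cfRow w i.1.1.1).2| := by gcongr
      _ = 2 * w * (q i.1 * |(cfRow w i.1.1.1).2|) + |(cfRow w i.1.1.1).2| := by ring
      _ ≤ 2 * w * H + H := by gcongr
      _ = _ := by ring
  have hinj : ∀ i k : ι, i ≠ k → digit i :: i.1.1.1 ≠ digit k :: k.1.1.1 := by
    rintro ⟨⟨⟨u, hu⟩, hu'⟩, j⟩ ⟨⟨⟨v, hv⟩, hv'⟩, k⟩ hik h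
    obtain ⟨h1, h2⟩ := List.cons.inj h
    dsimp only at h2
    subst h2
    have h3 := congrArg Subtype.val h1
    simp only [digit, Nat.cast_inj, add_right_inj] at h3
    exact hik (by rw [Fin.ext h3])
  set c : ℝ := 1 / (4 * ((2 * w + 1) * H) ^ 2) with hc
  have hc0 : 0 < c := by positivity
  have hcle : c ≤ 1 := by
    rw [hc, div_le_one (by positivity)]
    have : 1 ≤ (2 * w + 1) * H := by nlinarith
    nlinarith
  have hmain := card_mul_rpow_le_one_of_dimH_le (ι := ι) (isCompact_heckeCore w) hne
    (g := fun i => cfWord w (digit i :: i.1.1.1)) (fun i x hx => cfWord_mem_heckeCore hw _ hx)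
    (fun i => (continuousOn_cfWord hw _).mono fun x hx => hx.2)
    (fun i k hik => disjoint_image_cfWord hw (fun x hx => hx.2) i.1.1.2 k.1.1.2 (hlow i) (hlow k)
      (hinj i k hik)) (c := c.toNNReal) (Real.toNNReal_pos.2 hc0)
      (Real.toNNReal_le_one.2 hcle) (fun i x hx y hy => by
        rw [edist_dist, edist_dist, Real.dist_eq, Real.dist_eq]
        change ENNReal.ofReal c * _ ≤ _
        rw [← ENNReal.ofReal_mul hc0.le]
        refine ENNReal.ofReal_le_ofReal
          (le_trans ?_ (abs_sub_le_abs_cfWord_sub hw _ hx.2 hy.2))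
        have h1 := hupp i
        have h2 := (cfRow_bounds hw (digit i :: i.1.1.1)).1
        rw [hc, one_div_mul_eq_div]
        gcongr) hs
  have hcard : (Fintype.card ι : ℝ) = ∑ u ∈ A, (q u : ℝ) := by
    rw [Fintype.card_sigma]
    simp only [Fintype.card_fin]
    rw [Finset.univ_eq_attach, Finset.sum_attach A q]
    push_cast
    rfl
  rw [← hcard]
  simpa [hc0.le] using NNReal.coe_le_coe.2 hmain

theorem volume_thickening_heckeCore_le {w : ℝ} (hw : 2 < w) {s : ℝ≥0}
    (hs : dimH (heckeCore w) ≤ s) {h : ℝ} (h0 : 0 < h) (h1 : h < 1) :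
    volume (Metric.thickening h (Complex.ofReal '' heckeCore w)) ≤
      ENNReal.ofReal (8 * (3 / (1 - (w - 1)⁻¹) + 1) * (4 * (2 * w + 1) ^ 2) ^ (s : ℝ) *
        h ^ (2 - (s : ℝ))) := by
  rcases (heckeCore w).eq_empty_or_nonempty with he | hne
  · simp [he]
  set K : ℝ := 3 / (1 - (w - 1)⁻¹) with hK
  have hK0 : 0 < K := div_pos three_pos (by linarith [inv_sub_one_lt_one hw])
  obtain ⟨H, hH1, hHh⟩ : ∃ H : ℝ, 1 ≤ H ∧ h * H ^ 2 = 1 := by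
    refine ⟨(√h)⁻¹, (one_le_inv₀ (Real.sqrt_pos.2 h0)).2 (Real.sqrt_le_one.2 h1.le), ?_⟩
    rw [inv_pow, Real.sq_sqrt h0.le, mul_inv_cancel₀ h0.ne']
  have hH0 : 0 < H := by linarith
  let W := {u : List {n : ℤ // n ≠ 0} // |(cfRow w u).2| ≤ H}
  let r : W → ℝ := fun u => (K + 1) / (H * |(cfRow w u.1).2|)
  let R : W → Set ℂ := fun u => Icc (cfWord w u.1 0 - r u) (cfWord w u.1 0 + r u) ×ℂ Icc (-h) h
  have hdpos : ∀ u : W, 0 < |(cfRow w u.1).2| := fun u =>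
    one_pos.trans_le (cfRow_bounds hw u.1).1
  have hle : ∀ u : W, h ≤ 1 / (H * |(cfRow w u.1).2|) := by
    intro u
    have := hdpos u
    rw [le_div_iff₀ (by positivity), ← hHh, sq]
    gcongr
    exact u.2
  have hcover : Metric.thickening h (Complex.ofReal '' heckeCore w) ⊆ ⋃ u, R u := by
    intro z hz
    obtain ⟨_, ⟨x, hx, rfl⟩, hzx⟩ := Metric.mem_thickening_iff.1 hz
    obtain ⟨u, hu, hxu⟩ := exists_abs_sub_cfWord_zero_le hw (fun x hx => hx.2)
      (fun x hx hx0 => exists_eq_cfBranch_of_mem_heckeCore hw hx hx0) hH1 hx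
    rw [dist_eq_norm] at hzx
    have hre := (Complex.abs_re_le_norm _).trans_lt hzx
    have him := (Complex.abs_im_le_norm _).trans_lt hzx
    simp only [Complex.sub_re, Complex.ofReal_re, Complex.sub_im, Complex.ofReal_im,
      sub_zero] at hre him
    refine mem_iUnion.2 ⟨⟨u, hu⟩, ?_, abs_le.1 him.le⟩
    have h2 := hle ⟨u, hu⟩
    have h3 := abs_sub_le z.re x (cfWord w u 0)
    have h4 : |z.re - cfWord w u 0| ≤ r ⟨u, hu⟩ := by
      simp only [r, add_div]
      linarith
    rw [abs_le] at h4
    exact ⟨by linarith, by linarith⟩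
  have hvol : ∀ u : W, volume (R u) ≤
      ENNReal.ofReal (8 * (K + 1) * h ^ 2 * ⌊H / |(cfRow w u.1).2|⌋₊) := by
    intro u
    have hd := hdpos u
    rw [volume_reProdIm_Icc, ← ENNReal.ofReal_mul (by simp only [r]; ring_nf; positivity)]
    refine ENNReal.ofReal_le_ofReal ?_
    have h2 : 1 ≤ H / |(cfRow w u.1).2| := (one_le_div hd).2 u.2
    have h3 : (1 : ℝ) ≤ ⌊H / |(cfRow w u.1).2|⌋₊ := by
      exact_mod_cast (Nat.one_le_floor_iff _).2 h2
    have h4 := (Nat.lt_floor_add_one (H / |(cfRow w u.1).2|)).le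
    have h5 : 1 / (H * |(cfRow w u.1).2|) = h * (H / |(cfRow w u.1).2|) := by
      field_simp
      linarith
    calc _ = 4 * h * (K + 1) * (1 / (H * |(cfRow w u.1).2|)) := by simp only [r]; ring
      _ = 4 * (K + 1) * h ^ 2 * (H / |(cfRow w u.1).2|) := by rw [h5]; ring
      _ ≤ 4 * (K + 1) * h ^ 2 * (2 * ⌊H / |(cfRow w u.1).2|⌋₊) := by gcongr; linarith
      _ = _ := by ring
  calc volume (Metric.thickening h (Complex.ofReal '' heckeCore w))
      ≤ ∑' u, volume (R u) := (measure_mono hcover).trans (measure_iUnion_le _)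
    _ = ⨆ A : Finset W, ∑ u ∈ A, volume (R u) := ENNReal.tsum_eq_iSup_sum
    _ ≤ _ := iSup_le fun A => ?_
  calc ∑ u ∈ A, volume (R u)
      ≤ ∑ u ∈ A, ENNReal.ofReal (8 * (K + 1) * h ^ 2 * ⌊H / |(cfRow w u.1).2|⌋₊) :=
        Finset.sum_le_sum fun u _ => hvol u
    _ = ENNReal.ofReal (8 * (K + 1) * h ^ 2 * ∑ u ∈ A, (⌊H / |(cfRow w u.1).2|⌋₊ : ℝ)) := by
        rw [Finset.mul_sum, ENNReal.ofReal_sum_of_nonneg fun u _ => by positivity]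
    _ ≤ _ := ENNReal.ofReal_le_ofReal ?_
  have hsum := sum_floor_mul_rpow_le_one hw hH1 hs hne A
  have hc : 1 / (4 * ((2 * w + 1) * H) ^ 2) = h / (4 * (2 * w + 1) ^ 2) := by
    have : 0 < 2 * w + 1 := by linarith
    field_simp
    linarith
  have hw0 : 0 < 4 * (2 * w + 1) ^ 2 := by
    have : 0 < 2 * w + 1 := by linarith
    positivity
  rw [hc, Real.div_rpow h0.le hw0.le, ← mul_div_assoc, div_le_one (by positivity),
    ← le_div_iff₀ (by positivity)] at hsum
  calc _ ≤ 8 * (K + 1) * h ^ 2 * ((4 * (2 * w + 1) ^ 2) ^ (s : ℝ) / h ^ (s : ℝ)) := by gcongr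
    _ = _ := by
      rw [Real.rpow_sub h0, Real.rpow_two]
      ring

end Volume

theorem volume_thickening_le (w : ℝ) (hw : 2 < w)
    (Λ₀ : Set ℂ)
    (hΛ₀ : Λ₀ = limitSet (heckeGroup w) ∩ {x : ℂ | x.im = 0 ∧ -1 < x.re ∧ x.re < 1})
    (δ : ℝ) (hδ : δ = (dimH (limitSet (heckeGroup w))).toReal) :
    ∃ C > (0 : ℝ), ∃ h₀ > (0 : ℝ), ∀ h : ℝ, 0 < h → h < h₀ →
      volume (Metric.thickening h Λ₀) ≤ ENNReal.ofReal (C * h ^ (2 - δ)) := by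
  have hK : 0 < 3 / (1 - (w - 1)⁻¹) := div_pos three_pos (by linarith [inv_sub_one_lt_one hw])
  refine ⟨8 * (3 / (1 - (w - 1)⁻¹) + 1) * (4 * (2 * w + 1) ^ 2) ^ δ, ?_, 1, one_pos,
    fun h h0 h1 => ?_⟩
  · have : 0 < 2 * w + 1 := by linarith
    positivity
  have hsub : Λ₀ ⊆ Complex.ofReal '' heckeCore w := by
    rw [hΛ₀]
    rintro z ⟨hz, him, hre⟩
    have hzre : ((z.re : ℝ) : ℂ) = z := Complex.ext rfl him.symm
    exact ⟨z.re, mem_heckeCore_of_abs_lt_one hw (by rwa [hzre]) (abs_lt.2 hre), hzre⟩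
  have hdim : dimH (heckeCore w) ≤ (dimH (limitSet (heckeGroup w))).toNNReal := by
    rw [ENNReal.coe_toNNReal (dimH_limitSet_ne_top _)]
    exact dimH_heckeCore_le w
  rw [hδ]
  exact (measure_mono (Metric.thickening_subset_of_subset h hsub)).trans
    (volume_thickening_heckeCore_le hw hdim h0 h1)
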